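/- arXiv:math/0410048 — 2 statements merged into one kernel-verified Lean document; each statement's English description precedes it below -/
import Mathlib

section
/- Every metric tree T (a geodesic metric space in which every geodesic triangle is degenerate, i.e. each side is contained in the union of the other two) has Nagata dimension at most 1. -/
open Metric Set

/-- `X` has Nagata dimension at most `n` (witnessed by some constant `c > 0`):
for every `s > 0` there is a covering by sets of diameter `≤ c * s` such that every
set of diameter `≤ s` meets at most `n + 1` members of the covering. -/
def NagataProp (X : Type*) [MetricSpace X] (n : ℕ) : Prop :=
  ∃ c : ℝ, 0 < c ∧ ∀ s : ℝ, 0 < s → ∃ 𝓑 : Set (Set X),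
    (⋃₀ 𝓑 = univ) ∧
    (∀ B ∈ 𝓑, EMetric.diam B ≤ ENNReal.ofReal (c * s)) ∧
    (∀ E : Set X, EMetric.diam E ≤ ENNReal.ofReal s →
      ∃ T : Finset (Set X), T.card ≤ n + 1 ∧
        ∀ B ∈ 𝓑, (B ∩ E).Nonempty → B ∈ T)

/-- The Nagata (Assouad–Nagata) dimension of a metric space, as an element of `ℕ∞`. -/
noncomputable def nagataDim (X : Type*) [MetricSpace X] : ℕ∞ :=
  sInf {k : ℕ∞ | ∃ n : ℕ, k = n ∧ NagataProp X n}

/-- A metric space is geodesic if any two points are joined by an isometric image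
of the real interval `[0, dist x y]`. -/
def IsGeodesicSpace (T : Type*) [MetricSpace T] : Prop :=
  ∀ x y : T, ∃ γ : ℝ → T, γ 0 = x ∧ γ (dist x y) = y ∧
    ∀ s ∈ Icc (0 : ℝ) (dist x y), ∀ t ∈ Icc (0 : ℝ) (dist x y),
      dist (γ s) (γ t) = |s - t|

/-- A metric tree: a geodesic metric space that is `0`-hyperbolic, i.e. satisfies the
four-point condition; equivalently, all of its geodesic triangles are degenerate. -/
def IsMetricTree (T : Type*) [MetricSpace T] : Prop :=
  IsGeodesicSpace T ∧
    ∀ x y z w : T, dist x y + dist z w ≤ max (dist x z + dist y w) (dist x w + dist y z)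

theorem nagata_aux {T : Type*} [MetricSpace T] (o : T)
    (h4 : ∀ x y z w : T, dist x y + dist z w ≤ max (dist x z + dist y w) (dist x w + dist y z)) :
    NagataProp T 1 := by
  classical
  refine ⟨3, by norm_num, fun s hs => ?_⟩
  obtain ⟨f, hf1, hf2⟩ : ∃ f : T → ℕ, (∀ x, (f x : ℝ) * s ≤ dist x o) ∧
      ∀ x, dist x o < ((f x : ℝ) + 1) * s := by
    refine ⟨fun x => ⌊dist x o / s⌋₊, fun x => ?_, fun x => ?_⟩
    · have := Nat.floor_le (a := dist x o / s) (by positivity)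
      rwa [le_div_iff₀ hs] at this
    · have := Nat.lt_floor_add_one (dist x o / s)
      rwa [div_lt_iff₀ hs] at this
  let C : T → Set T := fun x =>
    {y | f y = f x ∧ 2 * ((f x : ℝ) * s) - s ≤ dist x o + dist y o - dist x y}
  have hself : ∀ x, x ∈ C x := fun x => ⟨rfl, by
    have := hf1 x
    rw [dist_self]; linarith⟩
  have hsymm : ∀ x y, y ∈ C x → x ∈ C y := by
    rintro x y ⟨h1, h2⟩
    refine ⟨h1.symm, ?_⟩
    rw [h1, dist_comm y x]; linarith
  have htrans : ∀ x y z, y ∈ C x → z ∈ C y → z ∈ C x := by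
    rintro x y z ⟨h1, h2⟩ ⟨h3, h5⟩
    refine ⟨h3.trans h1, ?_⟩
    rw [h1] at h5
    have := h4 x z y o
    rw [dist_comm z y] at this
    rcases le_max_iff.1 this with h | h <;> linarith
  have heq : ∀ x y, y ∈ C x → C y = C x := fun x y h => by
    ext z
    exact ⟨fun hz => htrans _ _ _ h hz, fun hz => htrans _ _ _ (hsymm _ _ h) hz⟩
  refine ⟨range C, ?_, ?_, ?_⟩
  · exact eq_univ_of_forall fun x => ⟨C x, ⟨x, rfl⟩, hself x⟩
  · rintro _ ⟨x, rfl⟩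
    refine Metric.ediam_le fun y hy z hz => ?_
    rw [edist_dist]
    apply ENNReal.ofReal_le_ofReal
    obtain ⟨h1, h2⟩ := htrans _ _ _ (hsymm _ _ hy) hz
    have h3 := hf2 y
    have h5 := hf2 z
    rw [h1] at h5
    linarith
  · intro E hE
    have hd : ∀ x ∈ E, ∀ y ∈ E, dist x y ≤ s := fun x hx y hy => by
      have := (Metric.edist_le_ediam_of_mem hx hy).trans hE
      rw [edist_dist] at this
      exact (ENNReal.ofReal_le_ofReal_iff hs.le).1 this
    have hsame : ∀ x ∈ E, ∀ y ∈ E, f x = f y → C x = C y := by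
      intro x hx y hy hxy
      refine heq _ _ ⟨hxy, ?_⟩
      have h1 := hf1 x
      have h2 := hf1 y
      have h3 := hd y hy x hx
      rw [hxy] at h1
      linarith
    rcases E.eq_empty_or_nonempty with rfl | hne
    · exact ⟨∅, by simp, by simp⟩
    obtain ⟨p, hp, hpm⟩ : ∃ p ∈ E, ∀ q ∈ E, f p ≤ f q := by
      obtain ⟨p, hp, h⟩ := (measure f).wf.has_min E hne
      exact ⟨p, hp, fun q hq => not_lt.1 (h q hq)⟩
    have hle : ∀ q ∈ E, f q ≤ f p + 1 := by
      intro q hq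
      by_contra! hlt
      have h1 : (f p : ℝ) + 2 ≤ f q := by exact_mod_cast hlt
      have h2 := hf1 q
      have h3 := hf2 p
      have h5 := hd q hq p hp
      have h6 := dist_triangle q p o
      nlinarith
    obtain ⟨q, hq⟩ : ∃ q, ∀ z ∈ E, f z = f p + 1 → C z = C q := by
      by_cases h : ∃ q ∈ E, f q = f p + 1
      · obtain ⟨q, hq, hqp⟩ := h
        exact ⟨q, fun z hz hzp => hsame z hz q hq (hzp.trans hqp.symm)⟩
      · push Not at h
        exact ⟨p, fun z hz hzp => absurd hzp (h z hz)⟩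
    refine ⟨{C p, C q}, Finset.card_le_two, ?_⟩
    rintro _ ⟨x, rfl⟩ ⟨z, hzx, hzE⟩
    rw [← heq x z hzx, Finset.mem_insert, Finset.mem_singleton]
    have h1 := hpm z hzE
    have h2 := hle z hzE
    rcases Nat.lt_or_ge (f p) (f z) with h | h
    · exact Or.inr (hq z hzE (by omega))
    · exact Or.inl (hsame z hzE p hp (by omega))

theorem nagataDim_le_one_of_metric_tree {T : Type*} [MetricSpace T] (hT : IsMetricTree T) :
    nagataDim T ≤ 1 := by
  refine sInf_le ⟨1, by simp, ?_⟩
  rcases isEmpty_or_nonempty T with h | ⟨⟨o⟩⟩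
  · refine ⟨1, one_pos, fun s _ => ⟨∅, ?_, by simp, fun E _ => ⟨∅, by simp, by simp⟩⟩⟩
    exact Subsingleton.elim _ _
  · exact nagata_aux o hT.2
end

section
/- Let T₁, …, Tₙ be metric trees, each containing more than one point. Then the product T₁ × … × Tₙ (with the sup or Euclidean product metric) has Nagata dimension exactly n. -/
open Metric Set

/-- vertices of a Kuhn simplex -/
def kv {n : ℕ} (x : Fin n → ℕ) (σ : Equiv.Perm (Fin n)) (k : ℕ) : Fin n → ℕ :=
  fun i => x i + if k ≤ (σ i : ℕ) then 1 else 0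

def kM {n : ℕ} (l : (Fin n → ℕ) → ℕ) (x : Fin n → ℕ) (σ : Equiv.Perm (Fin n)) :
    Matrix (Fin (n+1)) (Fin (n+1)) (ZMod 2) :=
  Matrix.of fun k j => if l (kv x σ k) = (j : ℕ) then 1 else 0

def kF {n : ℕ} (l : (Fin (n+1) → ℕ) → ℕ) (x : Fin (n+1) → ℕ) (σ : Equiv.Perm (Fin (n+1)))
    (k : Fin (n+2)) : ZMod 2 :=
  Matrix.det (Matrix.of fun r c : Fin (n+1) =>
    if l (kv x σ (k.succAbove r : Fin (n+2))) = (c : ℕ) + 1 then (1 : ZMod 2) else 0)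

lemma kM_det {n : ℕ} (l : (Fin (n+1) → ℕ) → ℕ) (hl : ∀ x, l x ≤ n+1)
    (x : Fin (n+1) → ℕ) (σ : Equiv.Perm (Fin (n+1))) :
    (kM l x σ).det = ∑ k, kF l x σ k := by
  have h := Matrix.det_updateCol_sum (kM l x σ) 0 (fun _ => 1)
  rw [one_smul] at h
  rw [← h, Matrix.det_succ_column_zero]
  refine Finset.sum_congr rfl fun k _ => ?_
  have h1 : ((-1 : ZMod 2)) = 1 := by decide
  have h2 : ∑ i, kM l x σ k i = 1 := by
    have hlt : l (kv x σ k) < n + 1 + 1 := Nat.lt_succ_of_le (hl _)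
    rw [Finset.sum_eq_single (⟨l (kv x σ k), hlt⟩ : Fin (n+1+1))]
    · simp [kM]
    · intro b _ hb
      simp only [kM, Matrix.of_apply]
      rw [if_neg]
      intro hh
      exact hb (Fin.ext hh.symm)
    · simp
  simp only [Matrix.updateCol_self, one_smul, h1, one_pow, one_mul, h2, kF]
  congr 1

lemma kF_mid {n : ℕ} (l : (Fin (n+1) → ℕ) → ℕ) (x : Fin (n+1) → ℕ)
    (k : Fin (n+2)) (h0 : k ≠ 0) (h1 : k ≠ Fin.last _) :
    ∑ σ, kF l x σ k = 0 := by
  have hk0 : 0 < (k:ℕ) := Nat.pos_of_ne_zero (fun h => h0 (Fin.ext h))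
  have hk1 : (k:ℕ) < n + 1 := by
    have := Fin.val_lt_last h1
    simpa using this
  let p : Fin (n+1) := ⟨k - 1, by omega⟩
  let q : Fin (n+1) := ⟨k, hk1⟩
  have hpq : p ≠ q := by
    intro h; have := congrArg Fin.val h; simp only [p, q] at this; omega
  have key : ∀ σ, kF l x (Equiv.swap p q * σ) k = kF l x σ k := by
    intro σ
    unfold kF
    congr 1
    ext r c
    have : kv x (Equiv.swap p q * σ) (k.succAbove r : Fin (n+2)) =
        kv x σ (k.succAbove r : Fin (n+2)) := by
      funext i
      have hne : ((k.succAbove r : Fin (n+2)) : ℕ) ≠ k := fun h =>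
        Fin.succAbove_ne k r (Fin.ext h)
      change x i + (if _ ≤ ((Equiv.swap p q (σ i) : Fin (n+1)) : ℕ) then 1 else 0) = x i + _
      congr 1
      generalize ((k.succAbove r : Fin (n+2)) : ℕ) = m at hne
      obtain ⟨s, hs⟩ : ∃ s, s = σ i := ⟨_, rfl⟩
      rw [← hs]
      rcases eq_or_ne s p with hp | hp
      · rw [hp, Equiv.swap_apply_left]
        simp only [p, q]
        refine if_congr ?_ rfl rfl
        omega
      rcases eq_or_ne s q with hq | hq
      · rw [hq, Equiv.swap_apply_right]
        simp only [p, q]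
        refine if_congr ?_ rfl rfl
        omega
      · rw [Equiv.swap_apply_of_ne_of_ne hp hq]
    simp only [Matrix.of_apply, this]
  refine Finset.sum_ninvolution (fun σ => Equiv.swap p q * σ) ?_ ?_ ?_ ?_
  · intro σ
    rw [key]
    exact CharTwo.add_self_eq_zero _
  · intro σ _ h
    have h2 : Equiv.swap p q = 1 := by simpa using h
    exact hpq (Equiv.swap_eq_one_iff.mp h2)
  · simp
  · intro σ
    rw [← mul_assoc, Equiv.swap_mul_self, one_mul]

lemma kF_last {n : ℕ} (l : (Fin (n+1) → ℕ) → ℕ) (x : Fin (n+1) → ℕ)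
    (σ : Equiv.Perm (Fin (n+1))) :
    kF l x σ (Fin.last _) =
      kF l (x + Pi.single ((finRotate (n+1) * σ).symm 0) 1) (finRotate (n+1) * σ) 0 := by
  unfold kF
  congr 1
  ext r c
  have : kv x σ ((Fin.last (n+1)).succAbove r : Fin (n+2)) =
    kv (x + Pi.single ((finRotate (n+1) * σ).symm 0) 1) (finRotate (n+1) * σ)
      ((0 : Fin (n+2)).succAbove r : Fin (n+2)) := by
    funext i
    simp only [kv, Fin.succAbove_last, Fin.succAbove_zero, Fin.val_castSucc, Fin.val_succ,
      Equiv.Perm.mul_apply, Pi.add_apply, coe_finRotate]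
    have hr := r.2
    by_cases hi : σ i = Fin.last n
    · have : (finRotate (n+1) * σ).symm 0 = i := by
        rw [Equiv.symm_apply_eq, Equiv.Perm.mul_apply, hi, finRotate_last]
      rw [this]
      simp [hi]
      omega
    · have : i ≠ (finRotate (n+1) * σ).symm 0 := by
        intro h
        apply hi
        have h2 := (Equiv.eq_symm_apply _).mp h
        rw [Equiv.Perm.mul_apply, ← finRotate_last] at h2
        exact (finRotate (n+1)).injective h2
      rw [Pi.single_eq_of_ne this]
      simp [hi]
  simp only [Matrix.of_apply, this]

lemma kF_last_sum {n : ℕ} (l : (Fin (n+1) → ℕ) → ℕ) (x : Fin (n+1) → ℕ) :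
    ∑ σ, kF l x σ (Fin.last _) = ∑ σ, kF l (x + Pi.single (σ.symm 0) 1) σ 0 := by
  refine Fintype.sum_equiv (Equiv.mulLeft (finRotate (n+1))) _ _ fun σ => ?_
  rw [kF_last, Equiv.coe_mulLeft]

theorem kuhn_aux (N : ℕ) : ∀ (n : ℕ) (l : (Fin n → ℕ) → ℕ) (_ : ∀ x, l x ≤ n)
    (_ : ∀ x (i : Fin n), x i = 0 → (i : ℕ) + 1 ≤ l x) (_ : ∀ x (i : Fin n), x i = N → l x ≠ (i : ℕ) + 1),
    ∑ x : Fin n → Fin N, ∑ σ, (kM l (fun i => (x i : ℕ)) σ).det = 1 := by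
  intro n
  induction n with
  | zero =>
    intro l hl _ _
    have : ∀ x, l x = 0 := fun x => Nat.le_zero.mp (hl x)
    simp [kM, this]
  | succ n ih =>
    intro l hl h0 hN
    -- the face value
    have zN : ∀ (x : Fin (n+1) → ℕ) (σ : Equiv.Perm (Fin (n+1))), x (σ.symm 0) = N →
        kF l x σ 0 = 0 := by
      intro x σ hx
      refine Matrix.det_eq_zero_of_column_eq_zero (σ.symm 0) fun r => ?_
      simp only [Matrix.of_apply]
      rw [if_neg]
      apply hN
      simp [kv, hx]
    have z0 : ∀ (x : Fin (n+1) → ℕ) (σ : Equiv.Perm (Fin (n+1))), x (σ.symm 0) = 0 →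
        σ.symm 0 ≠ 0 → kF l x σ 0 = 0 := by
      intro x σ hx hne
      refine Matrix.det_eq_zero_of_column_eq_zero 0 fun r => ?_
      simp only [Matrix.of_apply]
      rw [if_neg]
      have := h0 (kv x σ ((0 : Fin (n+2)).succAbove r : Fin (n+2))) (σ.symm 0) (by simp [kv, hx])
      have h3 : 0 < ((σ.symm 0 : Fin (n+1)) : ℕ) := Nat.pos_of_ne_zero fun h => hne (Fin.ext h)
      simp only [Fin.val_zero]
      omega
    have tele : ∀ σ : Equiv.Perm (Fin (n+1)),
        ∑ x : Fin (n+1) → Fin N, (kF l ((fun i => (x i : ℕ)) + Pi.single (σ.symm 0) 1) σ 0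
          + kF l (fun i => (x i : ℕ)) σ 0) =
        ∑ y : Fin n → Fin N, kF l (Fin.insertNth (σ.symm 0) 0 (fun i => (y i : ℕ))) σ 0 := by
      intro σ
      set i0 := σ.symm 0 with hi0
      rw [← (Fin.insertNthEquiv (fun _ => Fin N) i0).sum_comp, Fintype.sum_prod_type_right]
      refine Finset.sum_congr rfl fun y _ => ?_
      let g : ℕ → ZMod 2 := fun a =>
        kF l (Fin.insertNth (α := fun _ => ℕ) i0 a (fun i => (y i : ℕ))) σ 0
      have e1 : ∀ a : Fin N, (fun i => ((Fin.insertNthEquiv (fun _ => Fin N) i0 (a, y) i : Fin N) : ℕ))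
          = Fin.insertNth (α := fun _ => ℕ) i0 (a : ℕ) (fun i => (y i : ℕ)) := by
        intro a
        funext i
        refine Fin.succAboveCases i0 ?_ (fun j => ?_) i <;> simp [Fin.insertNthEquiv]
      have e2 : ∀ a : ℕ, (Fin.insertNth (α := fun _ => ℕ) i0 (a : ℕ) (fun i => (y i : ℕ)))
          + Pi.single i0 1 = Fin.insertNth (α := fun _ => ℕ) i0 (a+1 : ℕ) (fun i => (y i : ℕ)) := by
        intro a
        funext i
        refine Fin.succAboveCases i0 ?_ (fun j => ?_) i <;> simp
      have e3 : g N = 0 := zN _ _ (by simp [← hi0])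
      simp only [e1, e2]
      change ∑ a : Fin N, (g (a + 1) + g a) = g 0
      rw [Fin.sum_univ_eq_sum_range (fun a => g (a+1) + g a)]
      have := Finset.sum_range_sub g N
      simp only [CharTwo.sub_eq_add] at this
      rw [this, e3, zero_add]
    have step : ∑ x : Fin (n+1) → Fin N, ∑ σ, (kM l (fun i => (x i : ℕ)) σ).det =
        ∑ σ : Equiv.Perm (Fin (n+1)), ∑ y : Fin n → Fin N,
          kF l (Fin.insertNth (σ.symm 0) 0 (fun i => (y i : ℕ))) σ 0 := by
      rw [← Finset.sum_congr rfl fun σ _ => tele σ, Finset.sum_comm (γ := Equiv.Perm (Fin (n+1)))]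
      simp only [Finset.sum_add_distrib]
      have a1 : ∀ x : Fin (n+1) → ℕ, ∑ σ, (kM l x σ).det =
          ∑ σ, kF l x σ (Fin.last _) + ∑ σ, kF l x σ 0 := by
        intro x
        simp only [kM_det l hl]
        rw [Finset.sum_comm]
        rw [Finset.sum_eq_add_of_mem (Fin.last (n+1)) 0 (Finset.mem_univ _) (Finset.mem_univ _)
          (by simp [Fin.ext_iff])]
        intro k _ hk
        exact kF_mid l x k hk.2 hk.1
      simp only [a1, kF_last_sum, Finset.sum_add_distrib]
    rw [step, ← Equiv.Perm.decomposeFin.symm.sum_comp, Fintype.sum_prod_type,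
      Finset.sum_eq_single 0]
    · rw [Finset.sum_comm, ← ih (fun x' => l (Fin.cons 0 x') - 1)]
      · refine Finset.sum_congr rfl fun y _ => Finset.sum_congr rfl fun e _ => ?_
        have hs : (Equiv.Perm.decomposeFin.symm ((0 : Fin (n+1)), e)).symm 0 = 0 := by
          rw [Equiv.symm_apply_eq]; simp
        rw [hs]
        unfold kF kM
        congr 1
        ext r c
        have hv : kv (Fin.insertNth (α := fun _ => ℕ) 0 0 (fun i => (y i : ℕ)))
            (Equiv.Perm.decomposeFin.symm ((0 : Fin (n+1)), e))
            ((0 : Fin (n+2)).succAbove r : Fin (n+2)) =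
            Fin.cons (α := fun _ => ℕ) 0 (kv (fun i => (y i : ℕ)) e r) := by
          funext i
          refine Fin.cases ?_ (fun j => ?_) i
          · simp [kv]
          · simp [kv, -Fin.insertNth_zero']
            rw [← Fin.succAbove_zero_apply, Fin.insertNth_apply_succAbove]
        simp only [Matrix.of_apply]
        rw [hv]
        have := h0 (Fin.cons (α := fun _ => ℕ) 0 (kv (fun i => (y i : ℕ)) e r)) 0 (by simp)
        refine if_congr ?_ rfl rfl
        omega
      · intro x
        have := hl (Fin.cons 0 x)
        omega
      · intro x i hi
        have := h0 (Fin.cons 0 x) i.succ (by simpa using hi)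
        simp only [Fin.val_succ] at this
        omega
      · intro x i hi
        have := hN (Fin.cons 0 x) i.succ (by simpa using hi)
        simp only [Fin.val_succ] at this
        omega
    · intro p _ hp
      refine Finset.sum_eq_zero fun e _ => Finset.sum_eq_zero fun y _ => z0 _ _ (by simp) ?_
      intro h
      rw [Equiv.symm_apply_eq] at h
      apply hp
      rw [h]; simp
    · simp

theorem kuhn (N n : ℕ) (l : (Fin n → ℕ) → ℕ) (hl : ∀ x, l x ≤ n)
    (h0 : ∀ x (i : Fin n), x i = 0 → (i : ℕ) + 1 ≤ l x) (hN : ∀ x (i : Fin n), x i = N → l x ≠ (i : ℕ) + 1) :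
    ∃ (x : Fin n → ℕ) (σ : Equiv.Perm (Fin n)), ∀ j : Fin (n+1), ∃ k : ℕ,
      l (kv x σ k) = j := by
  have h := kuhn_aux N n l hl h0 hN
  by_contra hcon
  push Not at hcon
  rw [Finset.sum_eq_zero] at h
  · exact zero_ne_one h
  · intro x _
    refine Finset.sum_eq_zero fun σ _ => ?_
    obtain ⟨j, hj⟩ := hcon (fun i => (x i : ℕ)) σ
    refine Matrix.det_eq_zero_of_column_eq_zero j fun k => ?_
    simp only [kM, Matrix.of_apply]
    exact if_neg (hj k)

lemma nagata_lower {n : ℕ} (T : Fin n → Type*) [∀ i, MetricSpace (T i)]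
    (htree : ∀ i, IsMetricTree (T i)) (hnontriv : ∀ i, ∃ a b : T i, a ≠ b) (m : ℕ)
    (h : NagataProp (∀ i, T i) m) : n ≤ m := by
  classical
  by_contra hmn
  push Not at hmn
  choose a b hab using hnontriv
  choose γ hγ0 hγ1 hγ using fun i => (htree i).1 (a i) (b i)
  obtain ⟨c, hc, h⟩ := h
  have hL : ∀ i, 0 < dist (a i) (b i) := fun i => dist_pos.mpr (hab i)
  -- choose the scale
  obtain ⟨s, hs, hsδ⟩ : ∃ s : ℝ, 0 < s ∧ ∀ i, c * s < dist (a i) (b i) := by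
    have hne : (Finset.univ : Finset (Fin n)).Nonempty := ⟨⟨0, by omega⟩, Finset.mem_univ _⟩
    obtain ⟨j, -, hj⟩ := Finset.exists_min_image Finset.univ (fun i => dist (a i) (b i)) hne
    refine ⟨dist (a j) (b j) / (2 * c), div_pos (hL j) (by positivity), fun i => ?_⟩
    have : c * (dist (a j) (b j) / (2 * c)) = dist (a j) (b j) / 2 := by field_simp
    rw [this]
    have := hj i (Finset.mem_univ _)
    have := hL j
    linarith
  obtain ⟨N, hN0, hN⟩ : ∃ N : ℕ, 0 < N ∧ ∀ i, dist (a i) (b i) / N ≤ s := by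
    obtain ⟨N, hN⟩ := exists_nat_gt ((∑ i, dist (a i) (b i)) / s)
    have hN0 : (0:ℝ) < N := lt_of_le_of_lt (by positivity) hN
    refine ⟨N, by exact_mod_cast hN0, fun i => ?_⟩
    have h1 : dist (a i) (b i) ≤ ∑ i, dist (a i) (b i) :=
      Finset.single_le_sum (f := fun i => dist (a i) (b i)) (fun _ _ => dist_nonneg)
        (Finset.mem_univ i)
    rw [div_lt_iff₀ hs] at hN
    rw [div_le_iff₀ hN0]
    linarith
  have hNR : (0:ℝ) < N := by exact_mod_cast hN0
  obtain ⟨𝓑, hcov, hdiam, hmult⟩ := h s hs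
  let t : Fin n → ℕ → ℝ := fun i x => dist (a i) (b i) * ((min x N : ℕ) : ℝ) / N
  have ht : ∀ i x, t i x ∈ Icc (0:ℝ) (dist (a i) (b i)) := by
    intro i x
    have h1 : ((min x N : ℕ) : ℝ) ≤ N := by exact_mod_cast min_le_right _ _
    refine ⟨by positivity, ?_⟩
    rw [div_le_iff₀ hNR]
    exact mul_le_mul_of_nonneg_left h1 dist_nonneg
  let p : (Fin n → ℕ) → ∀ i, T i := fun x i => γ i (t i (x i))
  have hB : ∀ x, ∃ B ∈ 𝓑, p x ∈ B := fun x => by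
    have : p x ∈ ⋃₀ 𝓑 := by rw [hcov]; trivial
    exact this
  choose B hB𝓑 hpB using hB
  let lab : Set (∀ i, T i) → ℕ := fun A =>
    Finset.univ.sup fun i : Fin n => if ∃ z ∈ A, z i = b i then 0 else (i : ℕ) + 1
  obtain ⟨x, σ, hx⟩ := kuhn N n (fun x => lab (B x)) (by
      intro x
      refine Finset.sup_le fun i _ => ?_
      have := i.2
      split_ifs <;> omega) (by
      intro x i hi
      have hno : ¬ ∃ z ∈ B x, z i = b i := by
        rintro ⟨z, hz, hzi⟩
        have h1 : edist (p x) z ≤ ENNReal.ofReal (c * s) :=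
          (Metric.edist_le_ediam_of_mem (hpB x) hz).trans (hdiam _ (hB𝓑 x))
        have h2 : dist (p x) z ≤ c * s := by
          rwa [edist_dist, ENNReal.ofReal_le_ofReal_iff (by positivity)] at h1
        have h3 := dist_le_pi_dist (p x) z i
        have h4 : p x i = a i := by simp [p, t, hi, hγ0]
        rw [h4, hzi] at h3
        have := hsδ i
        linarith
      have := Finset.le_sup (f := fun i : Fin n => if ∃ z ∈ B x, z i = b i then 0 else (i : ℕ) + 1)
        (Finset.mem_univ i)
      simp only [if_neg hno] at this
      exact this) (by
      intro x i hi hl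
      have hyes : ∃ z ∈ B x, z i = b i := by
        refine ⟨p x, hpB x, ?_⟩
        have : t i (x i) = dist (a i) (b i) := by
          simp only [t, hi, min_self]
          field_simp
        simp only [p, this, hγ1]
      obtain ⟨j, -, hj⟩ := Finset.exists_mem_eq_sup Finset.univ ⟨i, Finset.mem_univ i⟩
        (fun i : Fin n => if ∃ z ∈ B x, z i = b i then 0 else (i : ℕ) + 1)
      change Finset.univ.sup (fun i : Fin n => if ∃ z ∈ B x, z i = b i then 0 else (i : ℕ) + 1)
        = _ at hl
      rw [hl] at hj
      split_ifs at hj with hz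
      · have : j = i := Fin.ext (by omega)
        subst this
        exact hz hyes)
  choose k hk using hx
  obtain ⟨S, hScard, hS⟩ := hmult (Set.range fun r : ℕ => p (kv x σ r)) (by
    refine Metric.ediam_le ?_
    rintro _ ⟨r, rfl⟩ _ ⟨r', rfl⟩
    rw [edist_dist]
    refine ENNReal.ofReal_le_ofReal ?_
    refine (dist_pi_le_iff hs.le).mpr fun i => ?_
    simp only [p]
    rw [hγ i _ (ht i _) _ (ht i _)]
    refine le_trans ?_ (hN i)
    have hd : |((min (kv x σ r i) N : ℕ) : ℝ) - ((min (kv x σ r' i) N : ℕ) : ℝ)| ≤ 1 := by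
      have : |((min (kv x σ r i) N : ℕ) : ℤ) - ((min (kv x σ r' i) N : ℕ) : ℤ)| ≤ 1 := by
        rw [abs_le]
        simp only [kv]
        split_ifs <;> omega
      exact_mod_cast this
    have e : t i (kv x σ r i) - t i (kv x σ r' i) = dist (a i) (b i) / N *
        (((min (kv x σ r i) N : ℕ) : ℝ) - ((min (kv x σ r' i) N : ℕ) : ℝ)) := by
      simp only [t]; ring
    rw [e, abs_mul, abs_of_nonneg (by positivity)]
    exact mul_le_of_le_one_right (by positivity) hd)
  have hsub : (Finset.univ : Finset (Fin (n+1))).map Fin.valEmbedding ⊆ S.image lab := by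
    intro q hq
    rw [Finset.mem_map] at hq
    obtain ⟨j, -, rfl⟩ := hq
    refine Finset.mem_image.mpr ⟨B (kv x σ (k j)), hS _ (hB𝓑 _) ⟨_, hpB _, ⟨k j, rfl⟩⟩, hk j⟩
  have h1 := Finset.card_le_card hsub
  rw [Finset.card_map, Finset.card_univ, Fintype.card_fin] at h1
  have h2 := Finset.card_image_le (s := S) (f := lab)
  omega

/-- coloured coverings of a tree -/
lemma tree_color {T : Type*} [MetricSpace T] (p : T)
    (h4 : ∀ x y z w : T, dist x y + dist z w ≤ max (dist x z + dist y w) (dist x w + dist y z))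
    (m : ℕ) (s : ℝ) (hs : 0 < s) : ∃ R : Fin (m+1) → T → T → Prop,
      (∀ k x y, R k x y → R k y x) ∧ (∀ k x y z, R k x y → R k y z → R k x z) ∧
      (∀ k x y, R k x y → dist x y ≤ 2 * (2 * m + 3) * s) ∧
      (∀ k x y, R k x x → R k y y → dist x y ≤ s → R k x y) ∧
      (∀ x, ∃ k₀, ∀ k, k ≠ k₀ → R k x x) := by
  let r : ℝ := 2 * s
  have hr : 0 < r := by positivity
  let q : T → ℤ := fun x => ⌊dist p x / r⌋
  have hq1 : ∀ x, r * q x ≤ dist p x := fun x => by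
    have := Int.floor_le (dist p x / r)
    rw [le_div_iff₀ hr] at this
    linarith
  have hq2 : ∀ x, dist p x < r * (q x + 1) := fun x => by
    have := Int.lt_floor_add_one (dist p x / r)
    rw [div_lt_iff₀ hr] at this
    linarith
  let M : ℤ := m + 1
  have hM : 0 < M := by positivity
  let A : Fin (m+1) → T → ℤ := fun k x => k + (q x - k) / M * M + 1
  -- `A k x - 1 ≤ q x < A k x - 1 + M`
  have hA1 : ∀ k x, A k x - 1 ≤ q x := fun k x => by
    have := Int.mul_ediv_add_emod (q x - k) M
    have := Int.emod_nonneg (q x - k) hM.ne'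
    simp only [A]; nlinarith
  have hA2 : ∀ k x, q x < A k x - 1 + M := fun k x => by
    have := Int.mul_ediv_add_emod (q x - k) M
    have := Int.emod_lt_of_pos (q x - k) hM
    simp only [A]; nlinarith
  have hA3 : ∀ k x y, A k x < A k y → A k x + M ≤ A k y := fun k x y h => by
    simp only [A] at h ⊢
    have : (q x - k) / M < (q y - k) / M := by
      by_contra hcon
      push Not at hcon
      nlinarith
    nlinarith
  refine ⟨fun k x y => A k x = A k y ∧ A k x ≤ q x ∧ A k y ≤ q y ∧
    r * (2 * A k x - 1) ≤ dist p x + dist p y - dist x y, ?_, ?_, ?_, ?_, ?_⟩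
  · rintro k x y ⟨h1, h2, h3, h5⟩
    refine ⟨h1.symm, h3, h2, ?_⟩
    rw [dist_comm y x, ← h1]; linarith
  · rintro k x y z ⟨h1, h2, h3, h5⟩ ⟨g1, g2, g3, g5⟩
    refine ⟨h1.trans g1, h2, g3, ?_⟩
    rw [← h1] at g5
    have := h4 x z p y
    rw [dist_comm x p, dist_comm z p, dist_comm z y] at this
    rcases le_max_iff.mp this with h | h <;> linarith
  · rintro k x y ⟨h1, h2, h3, h5⟩
    have a1 : (q x : ℝ) + 1 ≤ A k x - 1 + M := by exact_mod_cast hA2 k x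
    have a2 : (q y : ℝ) + 1 ≤ A k x - 1 + M := by rw [h1]; exact_mod_cast hA2 k y
    have b1 := hq2 x
    have b2 := hq2 y
    have c1 := mul_le_mul_of_nonneg_left a1 hr.le
    have c2 := mul_le_mul_of_nonneg_left a2 hr.le
    have hMr : (M : ℝ) = m + 1 := by simp [M]
    rw [hMr] at c1 c2
    have : dist x y ≤ r * (2 * m + 1) := by nlinarith
    simp only [r] at this
    nlinarith
  · rintro k x y ⟨-, h2, -, -⟩ ⟨-, h3, -, -⟩ hd
    have key : ∀ x y : T, A k y ≤ q y → dist x y ≤ s → ¬ A k x < A k y := by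
      intro x y h3 hd hlt
      have e1 := hA3 k x y hlt
      have e2 := hA2 k x
      have e3 : q x + 1 + 1 ≤ q y := by omega
      have e4 : (q x : ℝ) + 1 + 1 ≤ q y := by exact_mod_cast e3
      have e5 := mul_le_mul_of_nonneg_left e4 hr.le
      have := hq2 x
      have := hq1 y
      have := dist_triangle p x y
      have : r = 2 * s := rfl
      nlinarith
    have hAA : A k x = A k y :=
      le_antisymm (not_lt.mp (key y x h2 (by rwa [dist_comm]))) (not_lt.mp (key x y h3 hd))
    refine ⟨hAA, h2, h3, ?_⟩
    have a1 : (A k x : ℝ) ≤ q x := by exact_mod_cast h2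
    have a2 : (A k x : ℝ) ≤ q y := by rw [hAA]; exact_mod_cast h3
    have c1 := mul_le_mul_of_nonneg_left a1 hr.le
    have c2 := mul_le_mul_of_nonneg_left a2 hr.le
    have := hq1 x
    have := hq1 y
    have : r = 2 * s := rfl
    nlinarith
  · intro x
    have h0 : 0 ≤ q x % M := Int.emod_nonneg _ hM.ne'
    have h1 : q x % M < M := Int.emod_lt_of_pos _ hM
    refine ⟨⟨(q x % M).toNat, by simp only [M] at h0 h1 ⊢; omega⟩, fun k hk => ?_⟩
    have hle : A k x ≤ q x := by
      by_contra hcon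
      have e := hA1 k x
      have e2 : q x = k + (q x - k) / M * M := by simp only [A] at e hcon; omega
      apply hk
      apply Fin.ext
      have hkM : ((k : ℕ) : ℤ) < M := by have := k.2; simp only [M]; omega
      have : q x % M = k := by
        rw [e2, Int.add_mul_emod_self_right]
        exact Int.emod_eq_of_lt (by positivity) hkM
      simp [this]
    refine ⟨rfl, hle, hle, ?_⟩
    have a1 : (A k x : ℝ) ≤ q x := by exact_mod_cast hle
    have c1 := mul_le_mul_of_nonneg_left a1 hr.le
    have := hq1 x
    rw [dist_self]
    nlinarith

lemma nagata_upper {n : ℕ} (T : Fin n → Type*) [∀ i, MetricSpace (T i)]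
    (htree : ∀ i, IsMetricTree (T i)) (hnontriv : ∀ i, ∃ a b : T i, a ≠ b) :
    NagataProp (∀ i, T i) n := by
  classical
  choose a b hab using hnontriv
  refine ⟨2 * (2 * n + 3), by positivity, fun s hs => ?_⟩
  choose R hsymm htrans hdist hsep hmiss using fun i => tree_color (a i) (htree i).2 n s hs
  let Q : Fin (n+1) → (∀ i, T i) → (∀ i, T i) → Prop := fun k x y => ∀ i, R i k (x i) (y i)
  have Qs : ∀ k x y, Q k x y → Q k y x := fun k x y h i => hsymm i k _ _ (h i)
  have Qt : ∀ k x y z, Q k x y → Q k y z → Q k x z :=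
    fun k x y z h h' i => htrans i k _ _ _ (h i) (h' i)
  let cls : Fin (n+1) → (∀ i, T i) → Set (∀ i, T i) := fun k x => {y | Q k x y}
  refine ⟨{B | ∃ k x, B = cls k x}, ?_, ?_, ?_⟩
  · refine eq_univ_of_forall fun x => ?_
    choose k₀ hk₀ using fun i => hmiss i (x i)
    obtain ⟨k, hk⟩ : ∃ k, k ∉ Finset.univ.image k₀ := by
      by_contra hcon
      push Not at hcon
      have h1 : (Finset.univ : Finset (Fin (n+1))) ⊆ Finset.univ.image k₀ := fun k _ => hcon k
      have h2 := Finset.card_le_card h1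
      have h3 := Finset.card_image_le (s := (Finset.univ : Finset (Fin n))) (f := k₀)
      simp only [Finset.card_univ, Fintype.card_fin] at h2 h3
      omega
    refine ⟨cls k x, ⟨k, x, rfl⟩, fun i => hk₀ i k ?_⟩
    rintro rfl
    exact hk (Finset.mem_image_of_mem _ (Finset.mem_univ i))
  · rintro _ ⟨k, x, rfl⟩
    refine Metric.ediam_le fun y hy z hz => ?_
    rw [edist_dist]
    refine ENNReal.ofReal_le_ofReal ((dist_pi_le_iff (by positivity)).mpr fun i => ?_)
    exact hdist i k _ _ (Qt k y x z (Qs _ _ _ hy) hz i)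
  · intro E hE
    have hEd : ∀ u ∈ E, ∀ v ∈ E, dist u v ≤ s := fun u hu v hv => by
      have := (Metric.edist_le_ediam_of_mem hu hv).trans hE
      rwa [edist_dist, ENNReal.ofReal_le_ofReal_iff hs.le] at this
    let f : Fin (n+1) → Set (∀ i, T i) := fun k =>
      if h : ∃ x, (cls k x ∩ E).Nonempty then cls k h.choose else ∅
    refine ⟨Finset.univ.image f, ?_, ?_⟩
    · simpa using Finset.card_image_le (s := (Finset.univ : Finset (Fin (n+1)))) (f := f)
    · rintro _ ⟨k, x, rfl⟩ hne
      refine Finset.mem_image.mpr ⟨k, Finset.mem_univ _, ?_⟩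
      have h : ∃ x, (cls k x ∩ E).Nonempty := ⟨x, hne⟩
      simp only [f, dif_pos h]
      obtain ⟨u, hu, huE⟩ := h.choose_spec
      obtain ⟨v, hv, hvE⟩ := hne
      generalize h.choose = x' at hu
      have huu : Q k u u := Qt _ _ _ _ (Qs _ _ _ hu) hu
      have hvv : Q k v v := Qt _ _ _ _ (Qs _ _ _ hv) hv
      have huv : Q k u v := fun i => hsep i k _ _ (huu i) (hvv i)
        ((dist_le_pi_dist u v i).trans (hEd u huE v hvE))
      have hxx : Q k x' x := Qt _ _ _ _ hu (Qt _ _ _ _ huv (Qs _ _ _ hv))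
      ext z
      exact ⟨fun hz => Qt _ _ _ _ (Qs _ _ _ hxx) hz, fun hz => Qt _ _ _ _ hxx hz⟩

theorem nagataDim_pi_trees {n : ℕ} (T : Fin n → Type*) [∀ i, MetricSpace (T i)]
    (htree : ∀ i, IsMetricTree (T i)) (hnontriv : ∀ i, ∃ a b : T i, a ≠ b) :
    nagataDim (∀ i, T i) = n := by
  refine le_antisymm (sInf_le ⟨n, rfl, nagata_upper T htree hnontriv⟩) (le_sInf ?_)
  rintro _ ⟨m, rfl, hm⟩
  exact_mod_cast nagata_lower T htree hnontriv m hm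
end
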